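/- Let α, β ∈ ℂ² with ς ≡ α_A β^A ≠ 0 (where β^A = Σ_B ε^{AB} β_B). Define the symmetric valence-2 spinor κ_{AB} = α_{(A} β_{B)} and, for a scalar ψ ∈ ℂ, the symmetric valence-4 spinor Ψ_{ABCD} = ψ α_{(A} α_B β_C β_{D)}. Then Ψ_{ABPQ} κ^{PQ} = −(1/3) ψ ς² κ_{AB} for all index values, where κ^{PQ} = Σ ε^{PC} ε^{QD} κ_{CD}. In particular, if ψ ≠ 0 then κ is an eigenvector with nonzero eigenvalue of the linear map sending a symmetric valence-2 spinor μ_{AB} to Ψ_{ABPQ} μ^{PQ}. -/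

import Mathlib

open scoped BigOperators

noncomputable section

/-- The antisymmetric ε-spinor: ε₀₁ = 1, ε₁₀ = −1, ε₀₀ = ε₁₁ = 0. -/
def eps : Fin 2 → Fin 2 → ℂ
  | 0, 1 => 1
  | 1, 0 => -1
  | _, _ => 0

/-- Symmetrization of a valence-4 spinor: the average over all permutations of the indices. -/
def sym4 (T : Fin 2 → Fin 2 → Fin 2 → Fin 2 → ℂ) (A B C D : Fin 2) : ℂ :=
  (1 / 24 : ℂ) * ∑ σ : Equiv.Perm (Fin 4),
    T (![A, B, C, D] (σ 0)) (![A, B, C, D] (σ 1)) (![A, B, C, D] (σ 2)) (![A, B, C, D] (σ 3))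

theorem sym4_expand (α β : Fin 2 → ℂ) (A B C D : Fin 2) :
    sym4 (fun A B C D => α A * α B * β C * β D) A B C D = (1 / 6 : ℂ) *
      (α A * α B * β C * β D + α A * α C * β B * β D + α A * α D * β B * β C
       + α B * α C * β A * β D + α B * α D * β A * β C + α C * α D * β A * β B) := by
  unfold sym4
  have key : ∀ f : Equiv.Perm (Fin 4) → ℂ, ∑ σ, f σ =
      ∑ a : Fin 4, ∑ b : Fin 3, ∑ c : Fin 2, f (Equiv.Perm.decomposeFin.symm
        (a, Equiv.Perm.decomposeFin.symm (b, Equiv.Perm.decomposeFin.symm (c, 1)))) := by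
    intro f
    rw [← Equiv.Perm.decomposeFin.symm.sum_comp, Fintype.sum_prod_type]
    refine Finset.sum_congr rfl fun a _ => ?_
    rw [← Equiv.Perm.decomposeFin.symm.sum_comp, Fintype.sum_prod_type]
    refine Finset.sum_congr rfl fun b _ => ?_
    rw [← Equiv.Perm.decomposeFin.symm.sum_comp, Fintype.sum_prod_type]
    refine Finset.sum_congr rfl fun c _ => ?_
    rw [Fintype.sum_unique]
    congr
  rw [key]
  have h0 : ∀ (a : Fin 4) (b : Fin 3) (c : Fin 2),
      (Equiv.Perm.decomposeFin.symm (a, Equiv.Perm.decomposeFin.symm (b, Equiv.Perm.decomposeFin.symm (c, (1 : Equiv.Perm (Fin 1)))))) 0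
      = a := by decide
  have h1 : ∀ (a : Fin 4) (b : Fin 3) (c : Fin 2),
      (Equiv.Perm.decomposeFin.symm (a, Equiv.Perm.decomposeFin.symm (b, Equiv.Perm.decomposeFin.symm (c, (1 : Equiv.Perm (Fin 1)))))) 1
      = Equiv.swap 0 a b.succ := by decide
  have h2 : ∀ (a : Fin 4) (b : Fin 3) (c : Fin 2),
      (Equiv.Perm.decomposeFin.symm (a, Equiv.Perm.decomposeFin.symm (b, Equiv.Perm.decomposeFin.symm (c, (1 : Equiv.Perm (Fin 1)))))) 2
      = Equiv.swap 0 a (Equiv.swap 0 b c.succ).succ := by decide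
  have h3 : ∀ (a : Fin 4) (b : Fin 3) (c : Fin 2),
      (Equiv.Perm.decomposeFin.symm (a, Equiv.Perm.decomposeFin.symm (b, Equiv.Perm.decomposeFin.symm (c, (1 : Equiv.Perm (Fin 1)))))) 3
      = Equiv.swap 0 a (Equiv.swap 0 b (Equiv.swap 0 c 1).succ).succ := by decide
  have s1 : (1 : Fin 2).succ = 2 := rfl
  have s2 : (0 : Fin 2).succ = 1 := rfl
  have s3 : (1 : Fin 3).succ = 2 := rfl
  have s4 : (0 : Fin 3).succ = 1 := rfl
  have s5 : (2 : Fin 3).succ = 3 := rfl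
  simp only [h0, h1, h2, h3, Fin.sum_univ_four, Fin.sum_univ_three, Fin.sum_univ_two,
    Equiv.swap_apply_def, s1, s2, s3, s4, s5, Fin.reduceEq, if_true, if_false]
  simp only [Matrix.cons_val]
  ring

/-- For κ_{AB} = α_{(A}β_{B)} with ς = α_A β^A ≠ 0 and Ψ_{ABCD} = ψ α_{(A}α_B β_C β_{D)},
one has Ψ_{ABPQ} κ^{PQ} = −(1/3) ψ ς² κ_{AB}; in particular, if ψ ≠ 0 then κ is an
eigenvector with nonzero eigenvalue of μ ↦ Ψ_{ABPQ} μ^{PQ}. -/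
theorem killing_spinor_eigenvector
    (α β : Fin 2 → ℂ) (ψ ς : ℂ)
    (hς : ς = ∑ A, ∑ B, α A * eps A B * β B) (hςne : ς ≠ 0)
    (κ : Fin 2 → Fin 2 → ℂ)
    (hκ : ∀ A B, κ A B = (1 / 2 : ℂ) * (α A * β B + α B * β A))
    (Ψ : Fin 2 → Fin 2 → Fin 2 → Fin 2 → ℂ)
    (hΨ : ∀ A B C D, Ψ A B C D = ψ * sym4 (fun A B C D => α A * α B * β C * β D) A B C D) :
    (∀ A B, (∑ P, ∑ Q, Ψ A B P Q * ∑ C, ∑ D, eps P C * eps Q D * κ C D)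
        = -(1 / 3 : ℂ) * ψ * ς ^ 2 * κ A B)
    ∧ (ψ ≠ 0 → ∃ lam : ℂ, lam ≠ 0 ∧ ∀ A B,
        (∑ P, ∑ Q, Ψ A B P Q * ∑ C, ∑ D, eps P C * eps Q D * κ C D) = lam * κ A B) := by
  have main : ∀ A B, (∑ P, ∑ Q, Ψ A B P Q * ∑ C, ∑ D, eps P C * eps Q D * κ C D)
        = -(1 / 3 : ℂ) * ψ * ς ^ 2 * κ A B := by
    intro A B
    simp only [hς, hΨ, hκ, sym4_expand, Fin.sum_univ_two, eps]
    fin_cases A <;> fin_cases B <;> simp only [Fin.zero_eta, Fin.mk_one] <;> ring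
  refine ⟨main, fun hψ => ⟨-(1 / 3 : ℂ) * ψ * ς ^ 2, ?_, main⟩⟩
  exact mul_ne_zero (mul_ne_zero (by norm_num) hψ) (pow_ne_zero 2 hςne)

end
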